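/- Assume (f_i)_{i=1}^N satisfies the open set condition. Then there exists a constant D > 0, independent of k, such that for every k ≥ 1, e_{N_{k,r},r}(μ)^r ≥ D · Σ_{σ∈Λ_{k,r}} h(σ). -/

import Mathlib

open MeasureTheory Filter

/-- The `n`-th quantization error of order `r` of a Borel measure `P` on `ℝ^q`:
the infimum of `(∫ d(x,α)^r dP)^{1/r}` over finite sets `α` with `1 ≤ card α ≤ n`. -/
noncomputable def quantErr {q : ℕ} (P : Measure (EuclideanSpace ℝ (Fin q)))
    (n : ℕ) (r : ℝ) : ℝ :=
  sInf ((fun α : Finset (EuclideanSpace ℝ (Fin q)) =>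
      (∫ x, Metric.infDist x (α : Set (EuclideanSpace ℝ (Fin q))) ^ r ∂P) ^ (1 / r)) ''
    {α : Finset (EuclideanSpace ℝ (Fin q)) | α.Nonempty ∧ α.card ≤ n})

/-- Product of weights `g` along a word `σ` (equals `1` for the empty word). -/
noncomputable def prodw {N : ℕ} (g : Fin N → ℝ) (σ : List (Fin N)) : ℝ := (σ.map g).prod

/-- The composition `f_{σ_1} ∘ ⋯ ∘ f_{σ_n}` along a word `σ`. -/
def wordMap {q N : ℕ} (f : Fin N → EuclideanSpace ℝ (Fin q) → EuclideanSpace ℝ (Fin q))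
    (σ : List (Fin N)) : EuclideanSpace ℝ (Fin q) → EuclideanSpace ℝ (Fin q) :=
  σ.foldr (fun i g => f i ∘ g) id

/-- `h(σ) = h^{(1)}(σ) + h^{(2)}(σ)` where
`h^{(1)}(σ) = Σ_{j=0}^{|σ|-1} p0 p_{σ|_j} t_{σ^{(l)}_{-j}} s_σ^r` and `h^{(2)}(σ) = p_σ s_σ^r`. -/
noncomputable def hfun {N : ℕ} (r p0 : ℝ) (s t p : Fin N → ℝ) (σ : List (Fin N)) : ℝ :=
  (∑ j ∈ Finset.range σ.length, p0 * prodw p (σ.take j) * prodw t (σ.drop j)) * prodw s σ ^ r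
    + prodw p σ * prodw s σ ^ r

/-- `η̲_r := min_{1 ≤ i ≤ N} min{p0 t_i + p_i, t_i} · s_i^r`. -/
noncomputable def etaLow {N : ℕ} (r p0 : ℝ) (s t p : Fin N → ℝ) : ℝ :=
  ⨅ i, min (p0 * t i + p i) (t i) * s i ^ r

/-- The finite maximal antichain `Λ_{k,r} = {σ : h(σ|_{|σ|-1}) ≥ η̲_r/k > h(σ)}`. -/
def Lam {N : ℕ} (r p0 : ℝ) (s t p : Fin N → ℝ) (k : ℕ) : Set (List (Fin N)) :=
  {σ | σ ≠ [] ∧ etaLow r p0 s t p / k ≤ hfun r p0 s t p σ.dropLast ∧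
    hfun r p0 s t p σ < etaLow r p0 s t p / k}

/-- `a(x) = Σ_i (t_i s_i^r)^{x/(x+r)}` (also used for `b` with `p` in place of `t`). -/
noncomputable def afun {N : ℕ} (r : ℝ) (s t : Fin N → ℝ) (x : ℝ) : ℝ :=
  ∑ i, (t i * s i ^ r) ^ (x / (x + r))


section Words

variable {N : ℕ}

theorem prodw_append (g : Fin N → ℝ) (u v : List (Fin N)) :
    prodw g (u ++ v) = prodw g u * prodw g v := by
  simp [prodw]

theorem prodw_singleton (g : Fin N → ℝ) (i : Fin N) : prodw g [i] = g i := by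
  simp [prodw]

theorem prodw_nil (g : Fin N → ℝ) : prodw g [] = 1 := by
  simp [prodw]

theorem prodw_cons (g : Fin N → ℝ) (i : Fin N) (u : List (Fin N)) :
    prodw g (i :: u) = g i * prodw g u := by
  simp [prodw]

theorem prodw_pos {g : Fin N → ℝ} (hg : ∀ i, 0 < g i) (u : List (Fin N)) : 0 < prodw g u := by
  induction u with
  | nil => simp [prodw_nil]
  | cons i u ih => rw [prodw_cons]; exact mul_pos (hg i) ih

theorem prodw_le_one {g : Fin N → ℝ} (hg : ∀ i, g i ∈ Set.Ioo (0 : ℝ) 1) (u : List (Fin N)) :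
    prodw g u ≤ 1 := by
  induction u with
  | nil => simp [prodw_nil]
  | cons i u ih =>
    rw [prodw_cons]
    exact mul_le_one₀ (hg i).2.le (prodw_pos (fun i => (hg i).1) u).le ih

theorem prodw_lt_one {g : Fin N → ℝ} (hg : ∀ i, g i ∈ Set.Ioo (0 : ℝ) 1) {u : List (Fin N)}
    (hu : u ≠ []) : prodw g u < 1 := by
  cases u with
  | nil => exact absurd rfl hu
  | cons i u =>
    rw [prodw_cons]
    exact mul_lt_one_of_nonneg_of_lt_one_left (hg i).1.le (hg i).2 (prodw_le_one hg u)

theorem prodw_le_of_prefix {g : Fin N → ℝ} (hg : ∀ i, g i ∈ Set.Ioo (0 : ℝ) 1)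
    {u v : List (Fin N)} (h : u <+: v) : prodw g v ≤ prodw g u := by
  obtain ⟨w, rfl⟩ := h
  rw [prodw_append]
  exact mul_le_of_le_one_right (prodw_pos (fun i => (hg i).1) u).le (prodw_le_one hg w)

/-- The words at which a property of words fails for the first time are pairwise incomparable. -/
theorem eq_of_prefix_of_first_exit {A : Type*} {P : List A → Prop}
    (hP : ∀ u v, u <+: v → P v → P u) {u v : List A} (hu : ¬ P u)
    (hv : P v.dropLast) (h : u <+: v) : u = v := by
  by_contra hne
  obtain ⟨w, rfl⟩ := h
  have hw : w ≠ [] := by rintro rfl; simp at hne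
  rw [List.dropLast_append_of_ne_nil hw] at hv
  exact hu (hP _ _ (List.prefix_append _ _) hv)

theorem exists_prefix_first_exit {A : Type*} {P : List A → Prop} (h0 : P []) {w : List A}
    (hw : ¬ P w) : ∃ u, u <+: w ∧ u ≠ [] ∧ P u.dropLast ∧ ¬ P u := by
  induction w using List.reverseRecOn with
  | nil => exact absurd h0 hw
  | append_singleton w i ih =>
    by_cases h : P w
    · exact ⟨w ++ [i], List.prefix_rfl, by simp, by simpa using h, hw⟩
    · obtain ⟨u, hu, h'⟩ := ih h
      exact ⟨u, hu.trans (List.prefix_append _ _), h'⟩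

end Words

section Similitudes

variable {q N : ℕ} {f : Fin N → EuclideanSpace ℝ (Fin q) → EuclideanSpace ℝ (Fin q)}
  {s : Fin N → ℝ}

theorem wordMap_cons (i : Fin N) (u : List (Fin N)) :
    wordMap f (i :: u) = f i ∘ wordMap f u := rfl

theorem wordMap_append (u v : List (Fin N)) :
    wordMap f (u ++ v) = wordMap f u ∘ wordMap f v := by
  induction u with
  | nil => rfl
  | cons i u ih => rw [List.cons_append, wordMap_cons, wordMap_cons, ih]; rfl

theorem dist_wordMap (hf : ∀ i x y, dist (f i x) (f i y) = s i * dist x y)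
    (u : List (Fin N)) (x y : EuclideanSpace ℝ (Fin q)) :
    dist (wordMap f u x) (wordMap f u y) = prodw s u * dist x y := by
  induction u with
  | nil => simp [wordMap, prodw]
  | cons i u ih =>
    rw [wordMap_cons, Function.comp_apply, Function.comp_apply, hf, ih, prodw_cons, mul_assoc]

theorem continuous_of_dist_eq_mul {X : Type*} [PseudoMetricSpace X] {g : X → X} {c : ℝ}
    (hg : ∀ x y, dist (g x) (g y) = c * dist x y) : Continuous g := by
  have : LipschitzWith c.toNNReal g := LipschitzWith.of_dist_le_mul fun x y => by
    rw [hg]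
    exact mul_le_mul_of_nonneg_right (Real.le_coe_toNNReal c) dist_nonneg
  exact this.continuous

theorem surjective_of_dist_eq_mul {V : Type*} [NormedAddCommGroup V] [InnerProductSpace ℝ V]
    [FiniteDimensional ℝ V] {g : V → V} {c : ℝ} (hc : 0 < c)
    (hg : ∀ x y, dist (g x) (g y) = c * dist x y) : Function.Surjective g := by
  have hiso : Isometry fun x => c⁻¹ • g x := Isometry.of_dist_eq fun x y => by
    rw [dist_smul₀, hg, Real.norm_of_nonneg (by positivity), inv_mul_cancel_left₀ hc.ne']
  let A := hiso.affineIsometryOfStrictConvexSpace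
  have hA : Function.Surjective A := by
    have hlin : Function.Surjective A.toAffineMap.linear :=
      LinearMap.injective_iff_surjective.1
        (by rw [AffineMap.linear_injective_iff]; exact A.injective)
    exact A.toAffineMap.linear_surjective_iff.1 hlin
  intro y
  obtain ⟨x, hx⟩ := hA (c⁻¹ • y)
  refine ⟨x, ?_⟩
  have hx' : c⁻¹ • g x = c⁻¹ • y := hx
  exact smul_right_injective V (inv_ne_zero hc.ne') hx'

theorem surjective_wordMap (hs : ∀ i, s i ∈ Set.Ioo (0 : ℝ) 1)
    (hf : ∀ i x y, dist (f i x) (f i y) = s i * dist x y) (u : List (Fin N)) :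
    Function.Surjective (wordMap f u) :=
  surjective_of_dist_eq_mul (prodw_pos (fun i => (hs i).1) u) (dist_wordMap hf u)

theorem mapsTo_wordMap {U : Set (EuclideanSpace ℝ (Fin q))} (hU : ∀ i, f i '' U ⊆ U)
    (u : List (Fin N)) : Set.MapsTo (wordMap f u) U U := by
  induction u with
  | nil => exact fun x hx => hx
  | cons i u ih => exact fun x hx => hU i ⟨_, ih hx, rfl⟩

theorem wordMap_ne_of_not_prefix (hs : ∀ i, s i ∈ Set.Ioo (0 : ℝ) 1)
    (hf : ∀ i x y, dist (f i x) (f i y) = s i * dist x y)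
    {U : Set (EuclideanSpace ℝ (Fin q))} (hU : ∀ i, f i '' U ⊆ U)
    (hUd : Pairwise fun i j => Disjoint (f i '' U) (f j '' U))
    {u v : List (Fin N)} (huv : ¬ u <+: v) (hvu : ¬ v <+: u)
    {x y : EuclideanSpace ℝ (Fin q)} (hx : x ∈ U) (hy : y ∈ U) :
    wordMap f u x ≠ wordMap f v y := by
  induction u generalizing v with
  | nil => simp at huv
  | cons i u ih =>
    cases v with
    | nil => simp at hvu
    | cons j v =>
      intro h
      rw [wordMap_cons, wordMap_cons, Function.comp_apply, Function.comp_apply] at h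
      by_cases hij : i = j
      · subst hij
        rw [List.cons_prefix_cons] at huv hvu
        refine ih (by tauto) (by tauto) ?_
        rw [← dist_eq_zero, ← mul_right_inj' (hs i).1.ne', ← hf, h]
        simp
      · exact Set.disjoint_left.1 (hUd hij) ⟨_, mapsTo_wordMap hU u hx, rfl⟩
          ⟨_, mapsTo_wordMap hU v hy, h.symm⟩

/-- In a finite-dimensional space, the number of `c * ρ`-separated points in a ball of radius
`C * ρ` is bounded independently of `ρ` and of the centre. -/
theorem exists_separated_ncard_le {V : Type*} [NormedAddCommGroup V] [NormedSpace ℝ V]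
    [FiniteDimensional ℝ V] (C : ℝ) {c : ℝ} (hc : 0 < c) :
    ∃ K : ℕ, ∀ {ι : Type} (S : Set ι) (φ : ι → V) (z : V) (ρ : ℝ), 0 < ρ →
      (∀ i ∈ S, dist (φ i) z ≤ C * ρ) → (∀ i ∈ S, ∀ j ∈ S, i ≠ j → c * ρ ≤ dist (φ i) (φ j)) →
      S.Finite ∧ S.ncard ≤ K := by
  have : ProperSpace V := FiniteDimensional.proper ℝ V
  obtain ⟨T, -, hT, hcov⟩ := (isCompact_closedBall (0 : V) C).finite_cover_balls (half_pos hc)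
  refine ⟨T.ncard, fun {ι} S φ z ρ hρ hz hsep => ?_⟩
  have hex : ∀ i ∈ S, ∃ a ∈ T, dist (ρ⁻¹ • (φ i - z)) a < c / 2 := by
    intro i hi
    have : ρ⁻¹ • (φ i - z) ∈ Metric.closedBall (0 : V) C := by
      rw [mem_closedBall_zero_iff, norm_smul, Real.norm_of_nonneg (by positivity),
        ← dist_eq_norm, inv_mul_le_iff₀ hρ, mul_comm]
      exact hz i hi
    simpa using hcov this
  choose! g hgT hg using hex
  have hinj : Set.InjOn g S := by
    intro i hi j hj hij
    by_contra hne
    have h1 := hg i hi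
    have h2 := hg j hj
    rw [← hij] at h2
    have h3 := dist_triangle_right (ρ⁻¹ • (φ i - z)) (ρ⁻¹ • (φ j - z)) (g i)
    rw [dist_smul₀, dist_sub_right, Real.norm_of_nonneg (by positivity)] at h3
    have h4 : c ≤ ρ⁻¹ * dist (φ i) (φ j) := by
      rw [le_inv_mul_iff₀ hρ, mul_comm]
      exact hsep i hi j hj hne
    linarith
  exact ⟨Set.Finite.of_injOn (fun i hi => hgT i hi) hinj hT,
    Set.ncard_le_ncard_of_injOn g hgT hinj hT⟩

/-- The words of size comparable to that of `u` whose pieces of `E` come close to the piece of `u`. -/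
def nearWords (f : Fin N → EuclideanSpace ℝ (Fin q) → EuclideanSpace ℝ (Fin q))
    (s : Fin N → ℝ) (E : Set (EuclideanSpace ℝ (Fin q))) (u : List (Fin N)) :
    Set (List (Fin N)) :=
  {v | (v ≠ [] ∧ prodw s u < prodw s v.dropLast ∧ ¬ prodw s u < prodw s v) ∧
    ∃ x ∈ E, ∃ y ∈ E, dist (wordMap f v x) (wordMap f u y) < prodw s u}

theorem append_mem_nearWords (hs : ∀ i, s i ∈ Set.Ioo (0 : ℝ) 1)
    (hf : ∀ i x y, dist (f i x) (f i y) = s i * dist x y)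
    {E : Set (EuclideanSpace ℝ (Fin q))} (w : List (Fin N)) {u v : List (Fin N)}
    (hv : v ∈ nearWords f s E u) : w ++ v ∈ nearWords f s E (w ++ u) := by
  obtain ⟨⟨h0, h1, h2⟩, x, hx, y, hy, hxy⟩ := hv
  have hw := prodw_pos (fun i => (hs i).1) w
  refine ⟨⟨by simp [h0], ?_, ?_⟩, x, hx, y, hy, ?_⟩
  · rw [List.dropLast_append_of_ne_nil h0, prodw_append, prodw_append]
    exact mul_lt_mul_of_pos_left h1 hw
  · rw [prodw_append, prodw_append, mul_lt_mul_iff_right₀ hw]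
    exact h2
  · rw [wordMap_append, wordMap_append, Function.comp_apply, Function.comp_apply,
      dist_wordMap hf, prodw_append]
    exact mul_lt_mul_of_pos_left hxy hw

theorem exists_nearWords_ncard_le (hN : 0 < N) (hs : ∀ i, s i ∈ Set.Ioo (0 : ℝ) 1)
    (hf : ∀ i x y, dist (f i x) (f i y) = s i * dist x y)
    {E : Set (EuclideanSpace ℝ (Fin q))} (hE : Bornology.IsBounded E)
    (hOSC : ∃ U : Set (EuclideanSpace ℝ (Fin q)), U.Nonempty ∧ IsOpen U ∧
      (∀ i, f i '' U ⊆ U) ∧ Pairwise fun i j => Disjoint (f i '' U) (f j '' U)) :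
    ∃ K : ℕ, ∀ u, (nearWords f s E u).Finite ∧ (nearWords f s E u).ncard ≤ K := by
  obtain ⟨U, ⟨z, hz⟩, hUo, hUm, hUd⟩ := hOSC
  obtain ⟨δ, hδ, hball⟩ := Metric.isOpen_iff.1 hUo z hz
  obtain ⟨R, hR⟩ := hE.subset_closedBall z
  have : Nonempty (Fin N) := ⟨⟨0, hN⟩⟩
  obtain ⟨i₀, hi₀⟩ := Finite.exists_min s
  obtain ⟨K, hK⟩ := exists_separated_ncard_le (V := EuclideanSpace ℝ (Fin q)) (R + 1 + R)
    (mul_pos (hs i₀).1 hδ)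
  refine ⟨K, fun u => hK _ (fun v => wordMap f v z) (wordMap f u z) (prodw s u)
    (prodw_pos (fun i => (hs i).1) u) ?_ ?_⟩
  · rintro v ⟨⟨-, -, h2⟩, x, hx, y, hy, hxy⟩
    have hxz : dist z x ≤ R := by rw [dist_comm]; exact hR hx
    have hyz : dist y z ≤ R := hR hy
    have h3 := dist_triangle4 (wordMap f v z) (wordMap f v x) (wordMap f u y) (wordMap f u z)
    rw [dist_wordMap hf, dist_wordMap hf] at h3
    have hup := prodw_pos (fun i => (hs i).1) u
    have h4 : prodw s v * dist z x ≤ prodw s u * R :=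
      mul_le_mul (not_lt.1 h2) hxz dist_nonneg hup.le
    have h5 : prodw s u * dist y z ≤ prodw s u * R := mul_le_mul_of_nonneg_left hyz hup.le
    show dist (wordMap f v z) (wordMap f u z) ≤ _
    linarith
  · rintro v ⟨⟨hv0, hv1, hv2⟩, -⟩ w ⟨⟨hw0, hw1, hw2⟩, -⟩ hne
    have hmono : ∀ a b : List (Fin N), a <+: b → prodw s u < prodw s b → prodw s u < prodw s a :=
      fun a b hab hb => hb.trans_le (prodw_le_of_prefix hs hab)
    have hvw : ¬ v <+: w := fun h => hne (eq_of_prefix_of_first_exit hmono hv2 hw1 h)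
    have hwv : ¬ w <+: v := fun h => hne (eq_of_prefix_of_first_exit hmono hw2 hv1 h).symm
    by_contra! hlt
    have hvp := prodw_pos (fun i => (hs i).1) v
    have hsv : s i₀ * prodw s u ≤ prodw s v := by
      rw [← List.dropLast_append_getLast hv0, prodw_append, prodw_singleton, mul_comm]
      exact mul_le_mul hv1.le (hi₀ _) (hs _).1.le (prodw_pos (fun i => (hs i).1) _).le
    obtain ⟨y, hy⟩ := surjective_wordMap hs hf v (wordMap f w z)
    have hyU : y ∈ U := by
      apply hball
      rw [Metric.mem_ball, dist_comm]
      have h6 : prodw s v * dist z y < prodw s v * δ := by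
        rw [← dist_wordMap hf, hy]
        refine hlt.trans_le ?_
        nlinarith
      exact lt_of_mul_lt_mul_left h6 hvp.le
    exact wordMap_ne_of_not_prefix hs hf hUm hUd hvw hwv hyU hz hy

/-- Under the open set condition some word `τ` separates: the pieces of `E` of `u ++ τ` and `v ++ τ`
are apart, relative to their size, for all incomparable `u`, `v`. -/
theorem exists_separating_word (hN : 0 < N) (hs : ∀ i, s i ∈ Set.Ioo (0 : ℝ) 1)
    (hf : ∀ i x y, dist (f i x) (f i y) = s i * dist x y)
    {E : Set (EuclideanSpace ℝ (Fin q))} (hE : Bornology.IsBounded E)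
    (hEm : ∀ i, f i '' E ⊆ E)
    (hOSC : ∃ U : Set (EuclideanSpace ℝ (Fin q)), U.Nonempty ∧ IsOpen U ∧
      (∀ i, f i '' U ⊆ U) ∧ Pairwise fun i j => Disjoint (f i '' U) (f j '' U)) :
    ∃ τ : List (Fin N), ∀ u v, ¬ u <+: v → ¬ v <+: u → ∀ x ∈ E, ∀ y ∈ E,
      max (prodw s (u ++ τ)) (prodw s (v ++ τ)) ≤
        dist (wordMap f (u ++ τ) x) (wordMap f (v ++ τ) y) := by
  obtain ⟨K, hK⟩ := exists_nearWords_ncard_le hN hs hf hE hOSC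
  obtain ⟨τ, hτ0, hτ⟩ : ∃ τ : List (Fin N), τ ≠ [] ∧ ∀ u, u ≠ [] →
      (nearWords f s E u).ncard ≤ (nearWords f s E τ).ncard := by
    let S : Set ℕ := (fun u => (nearWords f s E u).ncard) '' {u | u ≠ []}
    have hne : S.Nonempty := ⟨_, [⟨0, hN⟩], by simp, rfl⟩
    have hbdd : BddAbove S := ⟨K, by rintro _ ⟨u, -, rfl⟩; exact (hK u).2⟩
    obtain ⟨τ, hτ0, hτ⟩ := Nat.sSup_mem hne hbdd
    exact ⟨τ, hτ0, fun u hu => by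
      have := le_csSup hbdd ⟨u, hu, rfl⟩
      rw [← hτ] at this
      exact this⟩
  have key : ∀ u v, ¬ u <+: v → ¬ v <+: u → prodw s (v ++ τ) ≤ prodw s (u ++ τ) →
      ∀ x ∈ E, ∀ y ∈ E,
        prodw s (u ++ τ) ≤ dist (wordMap f (u ++ τ) x) (wordMap f (v ++ τ) y) := by
    intro u v huv hvu hle x hx y hy
    by_contra! hlt
    obtain ⟨w, ⟨w', hw⟩, hw0, hw1, hw2⟩ :=
      exists_prefix_first_exit (P := fun w => prodw s (u ++ τ) < prodw s w) (w := v ++ τ)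
        (by rw [prodw_nil]; exact prodw_lt_one hs (by simp [hτ0])) (not_lt.2 hle)
    have hmem : w ∈ nearWords f s E (u ++ τ) := by
      refine ⟨⟨hw0, hw1, hw2⟩, _, mapsTo_wordMap hEm w' hy, x, hx, ?_⟩
      rw [← Function.comp_apply (f := wordMap f w), ← wordMap_append, hw, dist_comm]
      exact hlt
    have himg : (fun v => u ++ v) '' nearWords f s E τ = nearWords f s E (u ++ τ) := by
      refine Set.eq_of_subset_of_ncard_le ?_ ?_ (hK _).1
      · rintro _ ⟨a, ha, rfl⟩
        exact append_mem_nearWords hs hf u ha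
      · rw [Set.ncard_image_of_injective _ (List.append_right_injective u)]
        exact hτ _ (by simp [hτ0])
    rw [← himg] at hmem
    obtain ⟨a, -, rfl⟩ := hmem
    have hu : u <+: v ++ τ := ⟨a ++ w', by rw [← hw, List.append_assoc]⟩
    rcases List.prefix_or_prefix_of_prefix hu (List.prefix_append v τ) with h | h
    · exact huv h
    · exact hvu h
  refine ⟨τ, fun u v huv hvu x hx y hy => ?_⟩
  rcases le_total (prodw s (v ++ τ)) (prodw s (u ++ τ)) with h | h
  · rw [max_eq_left h]
    exact key u v huv hvu h x hx y hy
  · rw [max_eq_right h, dist_comm]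
    exact key v u hvu huv h y hy x hx

end Similitudes

section Weights

variable {N : ℕ} {r p0 : ℝ} {s t p : Fin N → ℝ}

/-- The total weight with which the image of `ν` under the maps of `w` enters `μ` explicitly. -/
noncomputable def nuMass (p0 : ℝ) (t p : Fin N → ℝ) (w : List (Fin N)) : ℝ :=
  ∑ j ∈ Finset.range w.length, p0 * prodw p (w.take j) * prodw t (w.drop j)

theorem hfun_eq (w : List (Fin N)) :
    hfun r p0 s t p w = (nuMass p0 t p w + prodw p w) * prodw s w ^ r := by
  rw [hfun, nuMass, add_mul]

theorem nuMass_append_singleton (w : List (Fin N)) (i : Fin N) :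
    nuMass p0 t p (w ++ [i]) = (nuMass p0 t p w + p0 * prodw p w) * t i := by
  rw [nuMass, nuMass, List.length_append, List.length_singleton, Finset.sum_range_succ, add_mul,
    Finset.sum_mul, List.take_left, List.drop_left, prodw_singleton]
  congr 1
  refine Finset.sum_congr rfl fun j hj => ?_
  have hj' : j ≤ w.length := (Finset.mem_range.1 hj).le
  rw [List.take_append_of_le_length hj', List.drop_append_of_le_length hj', prodw_append,
    prodw_singleton]
  ring

theorem nuMass_nonneg (hp0 : 0 ≤ p0) (ht : ∀ i, 0 < t i) (hp : ∀ i, 0 < p i)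
    (w : List (Fin N)) : 0 ≤ nuMass p0 t p w :=
  Finset.sum_nonneg fun _ _ =>
    mul_nonneg (mul_nonneg hp0 (prodw_pos hp _).le) (prodw_pos ht _).le

theorem hfun_pos (hs : ∀ i, 0 < s i) (hp0 : 0 ≤ p0) (ht : ∀ i, 0 < t i) (hp : ∀ i, 0 < p i)
    (w : List (Fin N)) : 0 < hfun r p0 s t p w := by
  rw [hfun_eq]
  exact mul_pos (add_pos_of_nonneg_of_pos (nuMass_nonneg hp0 ht hp w) (prodw_pos hp w))
    (Real.rpow_pos_of_pos (prodw_pos hs w) r)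

theorem hfun_append_singleton (hs : ∀ i, 0 < s i) (w : List (Fin N)) (i : Fin N) :
    hfun r p0 s t p (w ++ [i]) =
      (nuMass p0 t p w * t i + prodw p w * (p0 * t i + p i)) * s i ^ r * prodw s w ^ r := by
  rw [hfun_eq, nuMass_append_singleton, prodw_append, prodw_append, prodw_singleton,
    prodw_singleton, Real.mul_rpow (prodw_pos hs w).le (hs i).le]
  ring

theorem hfun_append_singleton_le (hr : 0 < r) (hs : ∀ i, s i ∈ Set.Ioo (0 : ℝ) 1) (hp0 : 0 ≤ p0)
    (ht : ∀ i, 0 < t i) (hp : ∀ i, 0 < p i) (ht1 : ∑ i, t i = 1) (hp1 : p0 + ∑ i, p i = 1)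
    (w : List (Fin N)) (i : Fin N) :
    hfun r p0 s t p (w ++ [i]) ≤ hfun r p0 s t p w := by
  have hti : t i ≤ 1 :=
    ht1 ▸ Finset.single_le_sum (fun j _ => (ht j).le) (Finset.mem_univ i)
  have hpi : p i ≤ ∑ j, p j := Finset.single_le_sum (fun j _ => (hp j).le) (Finset.mem_univ i)
  have hp0t : p0 * t i ≤ p0 := mul_le_of_le_one_right hp0 hti
  have hsr : s i ^ r ≤ 1 := Real.rpow_le_one (hs i).1.le (hs i).2.le hr.le
  have hsr0 : 0 ≤ s i ^ r := Real.rpow_nonneg (hs i).1.le r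
  have hm := nuMass_nonneg hp0 ht hp w
  have hpw := (prodw_pos hp w).le
  rw [hfun_append_singleton (fun i => (hs i).1), hfun_eq]
  refine mul_le_mul_of_nonneg_right ?_
    (Real.rpow_nonneg (prodw_pos (fun i => (hs i).1) w).le r)
  have h1 : nuMass p0 t p w * t i + prodw p w * (p0 * t i + p i)
      ≤ nuMass p0 t p w + prodw p w :=
    add_le_add (mul_le_of_le_one_right hm hti) (mul_le_of_le_one_right hpw (by linarith))
  calc _ ≤ (nuMass p0 t p w + prodw p w) * s i ^ r := mul_le_mul_of_nonneg_right h1 hsr0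
    _ ≤ _ := mul_le_of_le_one_right (by linarith) hsr

theorem hfun_le_of_prefix (hr : 0 < r) (hs : ∀ i, s i ∈ Set.Ioo (0 : ℝ) 1) (hp0 : 0 ≤ p0)
    (ht : ∀ i, 0 < t i) (hp : ∀ i, 0 < p i) (ht1 : ∑ i, t i = 1) (hp1 : p0 + ∑ i, p i = 1)
    {u v : List (Fin N)} (h : u <+: v) : hfun r p0 s t p v ≤ hfun r p0 s t p u := by
  obtain ⟨w, rfl⟩ := h
  induction w using List.reverseRecOn with
  | nil => simp
  | append_singleton w i ih =>
    rw [← List.append_assoc]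
    exact (hfun_append_singleton_le hr hs hp0 ht hp ht1 hp1 _ i).trans ih

theorem etaLow_le (i : Fin N) : etaLow r p0 s t p ≤ min (p0 * t i + p i) (t i) * s i ^ r :=
  ciInf_le (Set.finite_range _).bddBelow i

theorem etaLow_pos (hN : 0 < N) (hs : ∀ i, 0 < s i) (hp0 : 0 ≤ p0) (ht : ∀ i, 0 < t i)
    (hp : ∀ i, 0 < p i) : 0 < etaLow r p0 s t p := by
  have : Nonempty (Fin N) := ⟨⟨0, hN⟩⟩
  obtain ⟨i, hi⟩ :=
    exists_eq_ciInf_of_finite (f := fun i => min (p0 * t i + p i) (t i) * s i ^ r)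
  rw [etaLow, ← hi]
  exact mul_pos (lt_min (add_pos_of_nonneg_of_pos (mul_nonneg hp0 (ht i).le) (hp i)) (ht i))
    (Real.rpow_pos_of_pos (hs i) r)

theorem etaLow_mul_hfun_le (hs : ∀ i, 0 < s i) (hp0 : 0 ≤ p0) (ht : ∀ i, 0 < t i)
    (hp : ∀ i, 0 < p i) (w : List (Fin N)) (i : Fin N) :
    etaLow r p0 s t p * hfun r p0 s t p w ≤ hfun r p0 s t p (w ++ [i]) := by
  have hm := nuMass_nonneg hp0 ht hp w
  have hpw := (prodw_pos hp w).le
  calc etaLow r p0 s t p * hfun r p0 s t p w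
      ≤ min (p0 * t i + p i) (t i) * s i ^ r * hfun r p0 s t p w :=
        mul_le_mul_of_nonneg_right (etaLow_le i) (hfun_pos hs hp0 ht hp w).le
    _ = (nuMass p0 t p w * min (p0 * t i + p i) (t i)
          + prodw p w * min (p0 * t i + p i) (t i)) * s i ^ r * prodw s w ^ r := by
        rw [hfun_eq]; ring
    _ ≤ _ := by
        rw [hfun_append_singleton hs]
        refine mul_le_mul_of_nonneg_right (mul_le_mul_of_nonneg_right (add_le_add ?_ ?_)
          (Real.rpow_nonneg (hs i).le r)) (Real.rpow_nonneg (prodw_pos hs w).le r)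
        · exact mul_le_mul_of_nonneg_left (min_le_right _ _) hm
        · exact mul_le_mul_of_nonneg_left (min_le_left _ _) hpw

theorem etaLow_pow_mul_hfun_le (hN : 0 < N) (hs : ∀ i, 0 < s i) (hp0 : 0 ≤ p0)
    (ht : ∀ i, 0 < t i) (hp : ∀ i, 0 < p i) (u w : List (Fin N)) :
    etaLow r p0 s t p ^ w.length * hfun r p0 s t p u ≤ hfun r p0 s t p (u ++ w) := by
  induction w using List.reverseRecOn with
  | nil => simp
  | append_singleton w i ih =>
    rw [← List.append_assoc, List.length_append, List.length_singleton, pow_succ', mul_assoc]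
    exact (mul_le_mul_of_nonneg_left ih (etaLow_pos hN hs hp0 ht hp).le).trans
      (etaLow_mul_hfun_le hs hp0 ht hp _ i)

end Weights

section Measures

variable {q N : ℕ} {f : Fin N → EuclideanSpace ℝ (Fin q) → EuclideanSpace ℝ (Fin q)}
  {s t p : Fin N → ℝ} {p0 : ℝ} {ν μ : Measure (EuclideanSpace ℝ (Fin q))}

theorem measure_eq_sum_preimage (hfm : ∀ i, Measurable (f i))
    (hνss : ν = ∑ i, ENNReal.ofReal (t i) • ν.map (f i)) {A : Set (EuclideanSpace ℝ (Fin q))}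
    (hA : MeasurableSet A) : ν A = ∑ i, ENNReal.ofReal (t i) * ν (f i ⁻¹' A) := by
  conv_lhs => rw [hνss]
  rw [Measure.finsetSum_apply]
  exact Finset.sum_congr rfl fun i _ => by
    rw [Measure.smul_apply, Measure.map_apply (hfm i) hA, smul_eq_mul]

theorem mul_measureReal_preimage_le [IsFiniteMeasure ν] (hfm : ∀ i, Measurable (f i))
    (ht : ∀ i, 0 ≤ t i) (hνss : ν = ∑ i, ENNReal.ofReal (t i) • ν.map (f i))
    {A : Set (EuclideanSpace ℝ (Fin q))} (hA : MeasurableSet A) (i : Fin N) :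
    t i * ν.real (f i ⁻¹' A) ≤ ν.real A := by
  have h : ENNReal.ofReal (t i) * ν (f i ⁻¹' A) ≤ ν A := by
    rw [measure_eq_sum_preimage hfm hνss hA]
    exact Finset.single_le_sum (f := fun i => ENNReal.ofReal (t i) * ν (f i ⁻¹' A))
      (fun _ _ => zero_le) (Finset.mem_univ i)
  have h' := ENNReal.toReal_mono (measure_ne_top ν A) h
  rwa [ENNReal.toReal_mul, ENNReal.toReal_ofReal (ht i)] at h'

theorem inhomogeneous_measureReal_le [IsFiniteMeasure ν] [IsFiniteMeasure μ]
    (hfm : ∀ i, Measurable (f i)) (hp0 : 0 ≤ p0) (hp : ∀ i, 0 ≤ p i)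
    (hμss : μ = ENNReal.ofReal p0 • ν + ∑ i, ENNReal.ofReal (p i) • μ.map (f i))
    {A : Set (EuclideanSpace ℝ (Fin q))} (hA : MeasurableSet A) (i : Fin N) :
    p0 * ν.real A + p i * μ.real (f i ⁻¹' A) ≤ μ.real A := by
  have h : ENNReal.ofReal p0 * ν A + ENNReal.ofReal (p i) * μ (f i ⁻¹' A) ≤ μ A := by
    conv_rhs => rw [hμss]
    rw [Measure.add_apply, Measure.finsetSum_apply, Measure.smul_apply, smul_eq_mul]
    gcongr
    rw [← Measure.map_apply (hfm i) hA]
    exact Finset.single_le_sum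
      (f := fun i => (ENNReal.ofReal (p i) • μ.map (f i)) A)
      (fun _ _ => zero_le) (Finset.mem_univ i)
  have h' := ENNReal.toReal_mono (measure_ne_top μ A) h
  rwa [ENNReal.toReal_add (ENNReal.mul_ne_top ENNReal.ofReal_ne_top (measure_ne_top _ _))
    (ENNReal.mul_ne_top ENNReal.ofReal_ne_top (measure_ne_top _ _)), ENNReal.toReal_mul,
    ENNReal.toReal_mul, ENNReal.toReal_ofReal hp0, ENNReal.toReal_ofReal (hp i)] at h'

theorem measurable_wordMap (hfm : ∀ i, Measurable (f i)) (w : List (Fin N)) :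
    Measurable (wordMap f w) := by
  induction w with
  | nil => exact measurable_id
  | cons i w ih => exact (hfm i).comp ih

theorem word_measureReal_le [IsFiniteMeasure ν] [IsFiniteMeasure μ]
    (hfm : ∀ i, Measurable (f i)) (hp0 : 0 ≤ p0) (ht : ∀ i, 0 < t i) (hp : ∀ i, 0 < p i)
    (hνss : ν = ∑ i, ENNReal.ofReal (t i) • ν.map (f i))
    (hμss : μ = ENNReal.ofReal p0 • ν + ∑ i, ENNReal.ofReal (p i) • μ.map (f i))
    {A : Set (EuclideanSpace ℝ (Fin q))} (hA : MeasurableSet A) (w : List (Fin N)) :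
    nuMass p0 t p w * ν.real (wordMap f w ⁻¹' A) + prodw p w * μ.real (wordMap f w ⁻¹' A)
      ≤ μ.real A := by
  induction w using List.reverseRecOn with
  | nil => simp [nuMass, prodw_nil, wordMap]
  | append_singleton w i ih =>
    refine le_trans ?_ ih
    have hB := measurable_wordMap hfm w hA
    have h1 := mul_measureReal_preimage_le hfm (fun i => (ht i).le) hνss hB i
    have h2 := inhomogeneous_measureReal_le hfm hp0 (fun i => (hp i).le) hμss hB i
    have hpre : wordMap f (w ++ [i]) ⁻¹' A = f i ⁻¹' (wordMap f w ⁻¹' A) := by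
      rw [wordMap_append]; rfl
    rw [hpre, nuMass_append_singleton, prodw_append, prodw_singleton]
    have h3 := mul_le_mul_of_nonneg_left h1 (nuMass_nonneg hp0 ht hp w)
    have h4 := mul_le_mul_of_nonneg_left h2 (prodw_pos hp w).le
    have h5 := mul_le_mul_of_nonneg_left h1 (mul_nonneg hp0 (prodw_pos hp w).le)
    linarith

/-- A compactly supported self-similar measure is carried by every nonempty compact set that the
maps leave invariant. -/
theorem selfSimilar_measure_compl_eq_zero (hN : 0 < N) (hs : ∀ i, s i ∈ Set.Ioo (0 : ℝ) 1)
    (hf : ∀ i x y, dist (f i x) (f i y) = s i * dist x y)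
    {E : Set (EuclideanSpace ℝ (Fin q))} (hEcpt : IsCompact E) (hEne : E.Nonempty)
    (hEm : ∀ i, f i '' E ⊆ E) (ht : ∀ i, 0 ≤ t i) (ht1 : ∑ i, t i = 1)
    (hνc : ∃ K, IsCompact K ∧ ν Kᶜ = 0)
    (hνss : ν = ∑ i, ENNReal.ofReal (t i) • ν.map (f i)) : ν Eᶜ = 0 := by
  have hfm : ∀ i, Measurable (f i) := fun i => (continuous_of_dist_eq_mul (hf i)).measurable
  have : Nonempty (Fin N) := ⟨⟨0, hN⟩⟩
  obtain ⟨i₀, hi₀⟩ := Finite.exists_max s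
  obtain ⟨K, hK, hνK⟩ := hνc
  have hcont : Continuous fun x => Metric.infDist x E := Metric.continuous_infDist_pt E
  have hdist : ∀ i x, Metric.infDist (f i x) E ≤ s i₀ * Metric.infDist x E := by
    intro i x
    obtain ⟨y, hy, hxy⟩ := hEcpt.exists_infDist_eq_dist hEne x
    calc Metric.infDist (f i x) E ≤ dist (f i x) (f i y) :=
          Metric.infDist_le_dist_of_mem (hEm i ⟨y, hy, rfl⟩)
      _ = s i * dist x y := hf i x y
      _ ≤ s i₀ * Metric.infDist x E := by
          rw [hxy]; exact mul_le_mul_of_nonneg_right (hi₀ i) dist_nonneg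
  have hstep : ∀ (δ : ℝ) (n : ℕ), ν {x | δ < Metric.infDist x E}
      ≤ ν {x | δ < s i₀ ^ n * Metric.infDist x E} := by
    intro δ n
    induction n with
    | zero => simp
    | succ n ih =>
      refine ih.trans ?_
      have hmeas : MeasurableSet {x | δ < s i₀ ^ n * Metric.infDist x E} :=
        (isOpen_lt continuous_const (continuous_const.mul hcont)).measurableSet
      calc ν {x | δ < s i₀ ^ n * Metric.infDist x E}
          = ∑ i, ENNReal.ofReal (t i)
              * ν (f i ⁻¹' {x | δ < s i₀ ^ n * Metric.infDist x E}) :=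
            measure_eq_sum_preimage hfm hνss hmeas
        _ ≤ ∑ i, ENNReal.ofReal (t i)
              * ν {x | δ < s i₀ ^ (n + 1) * Metric.infDist x E} := by
            refine Finset.sum_le_sum fun i _ => mul_le_mul_right (measure_mono fun x hx => ?_) _
            have hx' : δ < s i₀ ^ n * Metric.infDist (f i x) E := hx
            show δ < s i₀ ^ (n + 1) * Metric.infDist x E
            rw [pow_succ, mul_assoc]
            exact hx'.trans_le
              (mul_le_mul_of_nonneg_left (hdist i x) (pow_nonneg (hs i₀).1.le n))
        _ = _ := by
            rw [← Finset.sum_mul, ← ENNReal.ofReal_sum_of_nonneg fun i _ => ht i, ht1,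
              ENNReal.ofReal_one, one_mul]
  obtain ⟨R, hR⟩ := (hK.image hcont).bddAbove
  have hnull : ∀ δ : ℝ, 0 < δ → ν {x | δ < Metric.infDist x E} = 0 := by
    intro δ hδ
    obtain ⟨n, hn⟩ := exists_pow_lt_of_lt_one (show 0 < δ / (|R| + 1) by positivity) (hs i₀).2
    refine le_antisymm ((hstep δ n).trans ?_) zero_le
    rw [← hνK]
    refine measure_mono fun x hx hxK => ?_
    have hxR : Metric.infDist x E ≤ |R| + 1 := by
      have := hR ⟨x, hxK, rfl⟩
      have := le_abs_self R
      simp only at *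
      linarith
    have hx' : δ < s i₀ ^ n * Metric.infDist x E := hx
    rw [lt_div_iff₀ (by positivity)] at hn
    have := mul_le_mul_of_nonneg_left hxR (pow_nonneg (hs i₀).1.le n)
    linarith
  have hsub : Eᶜ ⊆ ⋃ n : ℕ, {x | 1 / ((n : ℝ) + 1) < Metric.infDist x E} := by
    intro x hx
    obtain ⟨n, hn⟩ := exists_nat_one_div_lt
      ((hEcpt.isClosed.notMem_iff_infDist_pos hEne).1 hx)
    exact Set.mem_iUnion.2 ⟨n, hn⟩
  exact measure_mono_null hsub
    (measure_iUnion_null fun n => hnull _ (by positivity))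

theorem integrable_infDist_rpow [IsFiniteMeasure μ] (hμc : ∃ K, IsCompact K ∧ μ Kᶜ = 0)
    {r : ℝ} (hr : 0 ≤ r) (α : Set (EuclideanSpace ℝ (Fin q))) :
    Integrable (fun x => Metric.infDist x α ^ r) μ := by
  obtain ⟨K, hK, hμK⟩ := hμc
  have hcont : Continuous fun x => Metric.infDist x α ^ r :=
    (Metric.continuous_infDist_pt α).rpow_const fun _ => Or.inr hr
  obtain ⟨R, hR⟩ := hK.exists_bound_of_continuousOn hcont.continuousOn
  refine Integrable.of_bound hcont.aestronglyMeasurable R ?_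
  have : ∀ᵐ x ∂μ, x ∈ K := by rwa [ae_iff]
  filter_upwards [this] with x hx using hR x hx

/-- If the sets `A i` are disjoint and each is at distance at least `d i` from `α`, then `α` has
large distortion. -/
theorem sum_le_integral_infDist_rpow [IsFiniteMeasure μ] (hμc : ∃ K, IsCompact K ∧ μ Kᶜ = 0)
    {r : ℝ} (hr : 0 ≤ r) {α : Set (EuclideanSpace ℝ (Fin q))} (hα : α.Nonempty)
    {ι : Type*} (T : Finset ι) (A : ι → Set (EuclideanSpace ℝ (Fin q))) (d : ι → ℝ)
    (hA : ∀ i ∈ T, MeasurableSet (A i)) (hd : ∀ i ∈ T, 0 ≤ d i)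
    (hdisj : Set.Pairwise (T : Set ι) (Function.onFun Disjoint A))
    (hdist : ∀ i ∈ T, ∀ x ∈ A i, ∀ a ∈ α, d i ≤ dist x a) :
    ∑ i ∈ T, d i ^ r * μ.real (A i) ≤ ∫ x, Metric.infDist x α ^ r ∂μ := by
  have hint := integrable_infDist_rpow hμc hr α
  calc ∑ i ∈ T, d i ^ r * μ.real (A i)
      ≤ ∑ i ∈ T, ∫ x in A i, Metric.infDist x α ^ r ∂μ :=
        Finset.sum_le_sum fun i hi =>
          setIntegral_ge_of_const_le_real (hA i hi) (measure_ne_top _ _)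
            (fun x hx => Real.rpow_le_rpow (hd i hi)
              ((Metric.le_infDist hα).2 fun {a} ha => hdist i hi x hx a ha) hr) hint.integrableOn
    _ = ∫ x in ⋃ i ∈ T, A i, Metric.infDist x α ^ r ∂μ :=
        (integral_biUnion_finset T hA hdisj fun _ _ => hint.integrableOn).symm
    _ ≤ ∫ x, Metric.infDist x α ^ r ∂μ :=
        setIntegral_le_integral hint
          (Filter.Eventually.of_forall fun x => Real.rpow_nonneg Metric.infDist_nonneg r)

end Measures

theorem le_quantErr_rpow {q : ℕ} {P : Measure (EuclideanSpace ℝ (Fin q))} {n : ℕ} (hn : 1 ≤ n)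
    {r : ℝ} (hr : 0 < r) {B : ℝ} (hB : 0 ≤ B)
    (h : ∀ α : Finset (EuclideanSpace ℝ (Fin q)), α.Nonempty → α.card ≤ n →
      B ≤ ∫ x, Metric.infDist x (α : Set (EuclideanSpace ℝ (Fin q))) ^ r ∂P) :
    B ≤ quantErr P n r ^ r := by
  have h1 : B ^ (1 / r) ≤ quantErr P n r := by
    refine le_csInf (Set.Nonempty.image _ ⟨{0}, by simp, by simpa using hn⟩) ?_
    rintro _ ⟨α, ⟨hα, hcard⟩, rfl⟩
    exact Real.rpow_le_rpow hB (h α hα hcard) (by positivity)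
  calc B = (B ^ (1 / r)) ^ r := by rw [← Real.rpow_mul hB, one_div_mul_cancel hr.ne', Real.rpow_one]
    _ ≤ _ := Real.rpow_le_rpow (Real.rpow_nonneg hB _) h1 hr.le

theorem quantErr_nonneg {q : ℕ} (P : Measure (EuclideanSpace ℝ (Fin q))) (n : ℕ) (r : ℝ) :
    0 ≤ quantErr P n r := by
  refine Real.sInf_nonneg ?_
  rintro _ ⟨α, -, rfl⟩
  exact Real.rpow_nonneg
    (integral_nonneg fun x => Real.rpow_nonneg Metric.infDist_nonneg r) _

/-- If every point is related to at most one index, at least half of the indices are unrelated to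
any given set of few points. -/
theorem card_le_card_filter_unrelated {ι X : Type*} (W : Finset ι) (α : Finset X)
    (R : ι → X → Prop) [DecidablePred fun w => ∀ a ∈ α, ¬ R w a] {M : ℕ} (hW : 2 * M ≤ W.card)
    (hα : α.card ≤ M) (hR : ∀ u ∈ W, ∀ v ∈ W, ∀ a ∈ α, R u a → R v a → u = v) :
    M ≤ (W.filter fun w => ∀ a ∈ α, ¬ R w a).card := by
  have hbad : (W.filter fun w => ¬ ∀ a ∈ α, ¬ R w a).card ≤ α.card := by
    have hex : ∀ w ∈ W.filter (fun w => ¬ ∀ a ∈ α, ¬ R w a), ∃ a ∈ α, R w a := by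
      intro w hw
      simpa using (Finset.mem_filter.1 hw).2
    refine Finset.card_le_card_of_forall_subsingleton R hex ?_
    rintro a ha u ⟨hu, hua⟩ v ⟨hv, hva⟩
    exact hR u (Finset.mem_filter.1 hu).1 v (Finset.mem_filter.1 hv).1 a ha hua hva
  have := Finset.card_filter_add_card_filter_not (s := W) (fun w => ∀ a ∈ α, ¬ R w a)
  omega

/-- Comparable one-letter extensions of members of a prefix-free set coincide. -/
theorem eq_of_append_singleton_prefix {A : Type*} {L : Set (List A)}
    (hL : ∀ u ∈ L, ∀ v ∈ L, u <+: v → u = v) {u v : List A} (hu : u ∈ L) (hv : v ∈ L) {i j : A}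
    (h : u ++ [i] <+: v ++ [j]) : u ++ [i] = v ++ [j] := by
  have huv : u = v := by
    rcases List.prefix_or_prefix_of_prefix ((List.prefix_append u [i]).trans h)
      (List.prefix_append v [j]) with h' | h'
    · exact hL u hu v hv h'
    · exact (hL v hv u hu h').symm
  subst huv
  exact h.eq_of_length (by simp)

/-- The lower bound on the distortion of any set of at most `card L` points, for an antichain `L`
along which `hfun` is bounded below by `m`. -/
theorem card_mul_le_integral_infDist_rpow
    {q N : ℕ} (hN : 2 ≤ N) {r : ℝ} (hr : 0 < r)
    {f : Fin N → EuclideanSpace ℝ (Fin q) → EuclideanSpace ℝ (Fin q)}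
    {s : Fin N → ℝ} (hs : ∀ i, s i ∈ Set.Ioo (0 : ℝ) 1)
    (hf : ∀ i x y, dist (f i x) (f i y) = s i * dist x y)
    {E : Set (EuclideanSpace ℝ (Fin q))} (hEcpt : IsCompact E)
    {t : Fin N → ℝ} (ht : ∀ i, 0 < t i)
    {ν : Measure (EuclideanSpace ℝ (Fin q))} [IsProbabilityMeasure ν] (hνE : ν Eᶜ = 0)
    (hνss : ν = ∑ i, ENNReal.ofReal (t i) • ν.map (f i))
    {p0 : ℝ} {p : Fin N → ℝ} (hp0 : 0 ≤ p0) (hp01 : p0 ≤ 1) (hp : ∀ i, 0 < p i)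
    {μ : Measure (EuclideanSpace ℝ (Fin q))} [IsProbabilityMeasure μ]
    (hμc : ∃ K, IsCompact K ∧ μ Kᶜ = 0)
    (hμss : μ = ENNReal.ofReal p0 • ν + ∑ i, ENNReal.ofReal (p i) • μ.map (f i))
    {τ : List (Fin N)}
    (hτ : ∀ u v, ¬ u <+: v → ¬ v <+: u → ∀ x ∈ E, ∀ y ∈ E,
      max (prodw s (u ++ τ)) (prodw s (v ++ τ)) ≤
        dist (wordMap f (u ++ τ) x) (wordMap f (v ++ τ) y))
    (L : Finset (List (Fin N))) (hL : ∀ u ∈ L, ∀ v ∈ L, u <+: v → u = v)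
    {m : ℝ} (hm : ∀ u ∈ L, ∀ i, m ≤ hfun r p0 s t p (u ++ [i] ++ τ))
    {α : Finset (EuclideanSpace ℝ (Fin q))} (hα : α.Nonempty) (hcard : α.card ≤ L.card) :
    L.card * (p0 / 2 ^ r * m) ≤
      ∫ x, Metric.infDist x (α : Set (EuclideanSpace ℝ (Fin q))) ^ r ∂μ := by
  classical
  have hfm : ∀ i, Measurable (f i) := fun i => (continuous_of_dist_eq_mul (hf i)).measurable
  have hsp : ∀ w, 0 < prodw s w := prodw_pos fun i => (hs i).1
  have h2r : (0 : ℝ) < 2 ^ r := Real.rpow_pos_of_pos two_pos r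
  let I : Finset (Fin N) := {⟨0, by omega⟩, ⟨1, by omega⟩}
  have hI : I.card = 2 := Finset.card_pair (by simp)
  let W : Finset (List (Fin N)) := (L ×ˢ I).image fun x => x.1 ++ [x.2]
  have hWmem : ∀ w ∈ W, ∃ u ∈ L, ∃ i, u ++ [i] = w := by
    intro w hw
    obtain ⟨⟨u, i⟩, hui, rfl⟩ := Finset.mem_image.1 hw
    exact ⟨u, (Finset.mem_product.1 hui).1, i, rfl⟩
  have hWcard : 2 * L.card ≤ W.card := by
    rw [Finset.card_image_of_injective, Finset.card_product, hI, mul_comm]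
    rintro ⟨u, i⟩ ⟨v, j⟩ h
    simpa using List.append_inj' h (by simp)
  have hsep : ∀ u ∈ W, ∀ v ∈ W, u ≠ v → ∀ x ∈ E, ∀ y ∈ E,
      max (prodw s (u ++ τ)) (prodw s (v ++ τ)) ≤
        dist (wordMap f (u ++ τ) x) (wordMap f (v ++ τ) y) := by
    intro u hu v hv huv
    obtain ⟨u', hu', i, rfl⟩ := hWmem u hu
    obtain ⟨v', hv', j, rfl⟩ := hWmem v hv
    exact hτ _ _ (fun h => huv (eq_of_append_singleton_prefix (L := ↑L) hL hu' hv' h))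
      (fun h => huv (eq_of_append_singleton_prefix (L := ↑L) hL hv' hu' h).symm)
  let R : List (Fin N) → EuclideanSpace ℝ (Fin q) → Prop := fun w a =>
    ∃ x ∈ E, dist (wordMap f (w ++ τ) x) a < prodw s (w ++ τ) / 2
  let T := W.filter fun w => ∀ a ∈ α, ¬ R w a
  have hT : L.card ≤ T.card := by
    refine card_le_card_filter_unrelated W α R hWcard hcard ?_
    rintro u hu v hv a - ⟨x, hx, hxa⟩ ⟨y, hy, hya⟩
    by_contra huv
    have h1 := hsep u hu v hv huv x hx y hy
    have h2 := dist_triangle_right (wordMap f (u ++ τ) x) (wordMap f (v ++ τ) y) a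
    have h3 := le_max_left (prodw s (u ++ τ)) (prodw s (v ++ τ))
    have h4 := le_max_right (prodw s (u ++ τ)) (prodw s (v ++ τ))
    linarith
  let A : List (Fin N) → Set (EuclideanSpace ℝ (Fin q)) := fun w => wordMap f (w ++ τ) '' E
  have hAm : ∀ w, MeasurableSet (A w) := fun w =>
    (hEcpt.image (continuous_of_dist_eq_mul (dist_wordMap hf (w ++ τ)))).measurableSet
  have hmass : ∀ w, p0 * (nuMass p0 t p (w ++ τ) + prodw p (w ++ τ)) ≤ μ.real (A w) := by
    intro w
    have hpre : MeasurableSet (wordMap f (w ++ τ) ⁻¹' A w) := measurable_wordMap hfm _ (hAm w)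
    have hν1 : ν.real (wordMap f (w ++ τ) ⁻¹' A w) = 1 := by
      rw [measureReal_def, (prob_compl_eq_zero_iff hpre).1, ENNReal.toReal_one]
      exact measure_mono_null
        (Set.compl_subset_compl.2 (Set.subset_preimage_image _ E)) hνE
    have hμ1 : p0 ≤ μ.real (wordMap f (w ++ τ) ⁻¹' A w) := by
      have h := inhomogeneous_measureReal_le hfm hp0 (fun i => (hp i).le) hμss hpre
        ⟨0, by omega⟩
      rw [hν1, mul_one] at h
      exact (le_add_of_nonneg_right (mul_nonneg (hp _).le measureReal_nonneg)).trans h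
    have h := word_measureReal_le hfm hp0 ht hp hνss hμss (hAm w) (w ++ τ)
    rw [hν1, mul_one] at h
    have h1 := mul_le_mul_of_nonneg_left hμ1 (prodw_pos hp (w ++ τ)).le
    have h2 := mul_le_of_le_one_left (nuMass_nonneg hp0 ht hp (w ++ τ)) hp01
    linarith
  have hterm : ∀ w ∈ T, p0 / 2 ^ r * m ≤ (prodw s (w ++ τ) / 2) ^ r * μ.real (A w) := by
    intro w hw
    obtain ⟨u, hu, i, rfl⟩ := hWmem w (Finset.mem_filter.1 hw).1
    have hsr : 0 ≤ prodw s (u ++ [i] ++ τ) ^ r / 2 ^ r :=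
      div_nonneg (Real.rpow_nonneg (hsp _).le r) h2r.le
    calc p0 / 2 ^ r * m ≤ p0 / 2 ^ r * hfun r p0 s t p (u ++ [i] ++ τ) :=
          mul_le_mul_of_nonneg_left (hm u hu i) (div_nonneg hp0 h2r.le)
      _ = prodw s (u ++ [i] ++ τ) ^ r / 2 ^ r *
            (p0 * (nuMass p0 t p (u ++ [i] ++ τ) + prodw p (u ++ [i] ++ τ))) := by
          rw [hfun_eq]; ring
      _ ≤ prodw s (u ++ [i] ++ τ) ^ r / 2 ^ r * μ.real (A (u ++ [i])) :=
          mul_le_mul_of_nonneg_left (hmass _) hsr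
      _ = _ := by rw [Real.div_rpow (hsp _).le two_pos.le]
  by_cases hm0 : 0 ≤ m
  · calc L.card * (p0 / 2 ^ r * m) ≤ T.card * (p0 / 2 ^ r * m) :=
          mul_le_mul_of_nonneg_right (by exact_mod_cast hT)
            (mul_nonneg (div_nonneg hp0 h2r.le) hm0)
      _ ≤ ∑ w ∈ T, (prodw s (w ++ τ) / 2) ^ r * μ.real (A w) := by
          rw [← nsmul_eq_mul]
          exact Finset.card_nsmul_le_sum T _ _ hterm
      _ ≤ _ := by
          refine sum_le_integral_infDist_rpow hμc hr.le (by simpa using hα) T A _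
            (fun w _ => hAm w) (fun w _ => (half_pos (hsp _)).le) ?_ ?_
          · intro u hu v hv huv
            refine Set.disjoint_left.2 ?_
            rintro _ ⟨x, hx, rfl⟩ ⟨y, hy, hxy⟩
            have h := hsep u (Finset.mem_filter.1 hu).1 v (Finset.mem_filter.1 hv).1 huv
              x hx y hy
            rw [hxy, dist_self] at h
            exact absurd ((le_max_left _ _).trans h) (not_le.2 (hsp _))
          · rintro w hw _ ⟨x, hx, rfl⟩ a ha
            exact not_lt.1 fun h => (Finset.mem_filter.1 hw).2 a ha ⟨x, hx, h⟩
  · refine le_trans (mul_nonpos_of_nonneg_of_nonpos (Nat.cast_nonneg _) ?_)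
      (integral_nonneg fun x => Real.rpow_nonneg Metric.infDist_nonneg r)
    exact mul_nonpos_of_nonneg_of_nonpos (div_nonneg hp0 h2r.le) (not_le.1 hm0).le

/-- Lemma (Zhu): under the OSC, there is a constant `D > 0` independent of `k` with
`e_{N_{k,r},r}(μ)^r ≥ D Σ_{σ ∈ Λ_{k,r}} h(σ)` for all `k ≥ 1`. -/
theorem quantErr_ge_const_mul_sum_h_over_antichain
    (q N : ℕ) (hq : 1 ≤ q) (hN : 2 ≤ N) (r : ℝ) (hr : 0 < r)
    (f : Fin N → EuclideanSpace ℝ (Fin q) → EuclideanSpace ℝ (Fin q))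
    (s : Fin N → ℝ) (hs : ∀ i, s i ∈ Set.Ioo (0 : ℝ) 1)
    (hf : ∀ i x y, dist (f i x) (f i y) = s i * dist x y)
    (E : Set (EuclideanSpace ℝ (Fin q)))
    (hEcpt : IsCompact E) (hEne : E.Nonempty) (hEss : E = ⋃ i, f i '' E)
    (hEdiam : Metric.diam E = 1)
    (hOSC : ∃ U : Set (EuclideanSpace ℝ (Fin q)), U.Nonempty ∧ IsOpen U ∧
      (∀ i, f i '' U ⊆ U) ∧ Pairwise fun i j => Disjoint (f i '' U) (f j '' U))
    (t : Fin N → ℝ) (ht : ∀ i, 0 < t i) (ht1 : ∑ i, t i = 1)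
    (ν : Measure (EuclideanSpace ℝ (Fin q))) (hνP : IsProbabilityMeasure ν)
    (hνc : ∃ K, IsCompact K ∧ ν Kᶜ = 0)
    (hνss : ν = ∑ i, ENNReal.ofReal (t i) • ν.map (f i))
    (p0 : ℝ) (p : Fin N → ℝ) (hp0 : 0 < p0) (hp : ∀ i, 0 < p i)
    (hp1 : p0 + ∑ i, p i = 1)
    (μ : Measure (EuclideanSpace ℝ (Fin q))) (hμP : IsProbabilityMeasure μ)
    (hμc : ∃ K, IsCompact K ∧ μ Kᶜ = 0)
    (hμss : μ = ENNReal.ofReal p0 • ν + ∑ i, ENNReal.ofReal (p i) • μ.map (f i))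
    :
    ∃ D : ℝ, 0 < D ∧ ∀ k : ℕ, 1 ≤ k →
      D * (∑ᶠ σ ∈ Lam r p0 s t p k, hfun r p0 s t p σ)
        ≤ quantErr μ ((Lam r p0 s t p k).ncard) r ^ r := by
  have hN0 : 0 < N := by omega
  have hs0 : ∀ i, 0 < s i := fun i => (hs i).1
  have hEm : ∀ i, f i '' E ⊆ E := fun i => by
    conv_rhs => rw [hEss]
    exact Set.subset_iUnion (fun i => f i '' E) i
  have hp01 : p0 ≤ 1 := by
    linarith [Finset.sum_nonneg fun i (_ : i ∈ Finset.univ) => (hp i).le]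
  have hη := etaLow_pos (r := r) hN0 hs0 hp0.le ht hp
  have hνE := selfSimilar_measure_compl_eq_zero hN0 hs hf hEcpt hEne hEm (fun i => (ht i).le)
    ht1 hνc hνss
  obtain ⟨τ, hτ⟩ := exists_separating_word hN0 hs hf hEcpt.isBounded hEm hOSC
  set η := etaLow r p0 s t p
  have h2r : (0 : ℝ) < 2 ^ r := Real.rpow_pos_of_pos two_pos r
  refine ⟨p0 / 2 ^ r * η ^ (τ.length + 2), by positivity, fun k hk => ?_⟩
  have hk0 : (0 : ℝ) < k := by exact_mod_cast hk
  have hhpos := hfun_pos (r := r) hs0 hp0.le ht hp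
  have htrivial : ∑ᶠ σ ∈ Lam r p0 s t p k, hfun r p0 s t p σ = 0 →
      p0 / 2 ^ r * η ^ (τ.length + 2) * (∑ᶠ σ ∈ Lam r p0 s t p k, hfun r p0 s t p σ)
        ≤ quantErr μ ((Lam r p0 s t p k).ncard) r ^ r := fun h => by
    rw [h, mul_zero]
    exact Real.rpow_nonneg (quantErr_nonneg _ _ _) r
  by_cases hfin : (Lam r p0 s t p k).Finite
  swap
  · refine htrivial (finsum_mem_eq_zero_of_infinite ?_)
    rwa [Function.support_eq_univ fun σ => (hhpos σ).ne', Set.inter_univ]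
  rcases (Lam r p0 s t p k).eq_empty_or_nonempty with hempty | hne
  · exact htrivial (by rw [hempty, finsum_mem_empty])
  obtain ⟨L, hL⟩ := hfin.exists_finset_coe
  rw [← hL] at hne ⊢
  rw [finsum_mem_coe_finset, Set.ncard_coe_finset]
  have hLam : ∀ σ ∈ L, σ ∈ Lam r p0 s t p k := fun σ hσ => by rw [← hL]; exact hσ
  have hanti : ∀ u ∈ L, ∀ v ∈ L, u <+: v → u = v := fun u hu v hv huv =>
    eq_of_prefix_of_first_exit (P := fun w => η / k ≤ hfun r p0 s t p w)
      (fun a b hab hb => hb.trans (hfun_le_of_prefix hr hs hp0.le ht hp ht1 hp1 hab))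
      (not_le.2 (hLam u hu).2.2) (hLam v hv).2.1 huv
  have hlow : ∀ u ∈ L, ∀ i, η ^ (τ.length + 2) * (η / k) ≤ hfun r p0 s t p (u ++ [i] ++ τ) := by
    intro u hu i
    obtain ⟨hu0, hu1, -⟩ := hLam u hu
    have h := etaLow_pow_mul_hfun_le (r := r) hN0 hs0 hp0.le ht hp u.dropLast
      ([u.getLast hu0] ++ ([i] ++ τ))
    have hlen : ([u.getLast hu0] ++ ([i] ++ τ)).length = τ.length + 2 := by simp
    rw [hlen, ← List.append_assoc u.dropLast, List.dropLast_append_getLast,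
      ← List.append_assoc] at h
    exact (mul_le_mul_of_nonneg_left hu1 (pow_nonneg hη.le _)).trans h
  have hB : 0 ≤ L.card * (p0 / 2 ^ r * (η ^ (τ.length + 2) * (η / k))) :=
    mul_nonneg (Nat.cast_nonneg _) (mul_nonneg (div_nonneg hp0.le h2r.le)
      (mul_nonneg (pow_nonneg hη.le _) (div_nonneg hη.le hk0.le)))
  refine le_trans ?_ (le_quantErr_rpow (Finset.card_pos.2 (Finset.coe_nonempty.1 hne)) hr hB
    fun α hα hcard =>
    card_mul_le_integral_infDist_rpow hN hr hs hf hEcpt ht hνE hνss hp0.le hp01 hp hμc hμss hτ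
      L hanti hlow hα hcard)
  have hsum : ∑ σ ∈ L, hfun r p0 s t p σ ≤ L.card * (η / k) := by
    rw [← nsmul_eq_mul]
    exact Finset.sum_le_card_nsmul L _ _ fun σ hσ => (hLam σ hσ).2.2.le
  calc _ ≤ p0 / 2 ^ r * η ^ (τ.length + 2) * (L.card * (η / k)) :=
        mul_le_mul_of_nonneg_left hsum (by positivity)
    _ = _ := by ring
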